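/- arXiv:1003.4160 — 2 statements merged into one kernel-verified Lean document; each statement's English description precedes it below -/
import Mathlib

section
/- Let z̃ : ℝ² → ℝ be locally integrable and satisfy, in the sense of distributions, ∂_t z̃(s,t) = |P| ∂_s z̃(s,t) on ℝ², where |P| > 0 is a constant. Then there exists ẑ : ℝ → ℝ locally integrable such that z̃(s,t) = ẑ(s/|P| + t) for almost every (s,t). -/
open MeasureTheory

section Translation

variable {E : Type*} [NormedAddCommGroup E] [NormedSpace ℝ E] [FiniteDimensional ℝ E]
  [MeasurableSpace E] [BorelSpace E] {μ : Measure E}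

theorem hasDerivAt_integral_mul_comp_add_smul {f φ : E → ℝ} (hf : LocallyIntegrable f μ)
    (hφ : ContDiff ℝ 1 φ) (hφc : HasCompactSupport φ) (e : E) (τ₀ : ℝ) :
    HasDerivAt (fun τ : ℝ => ∫ p, f p * φ (p + τ • e) ∂μ)
      (∫ p, f p * fderiv ℝ φ (p + τ₀ • e) e ∂μ) τ₀ := by
  have hcd : Continuous fun x => fderiv ℝ φ x e :=
    (hφ.continuous_fderiv one_ne_zero).clm_apply continuous_const
  obtain ⟨C, hC⟩ := (hφc.fderiv_apply (𝕜 := ℝ) e).exists_bound_of_continuous hcd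
  set K : Set E := (fun q : E × ℝ => q.1 - q.2 • e) '' (tsupport φ ×ˢ Metric.closedBall τ₀ 1)
  have hK : IsCompact K :=
    (hφc.isCompact.prod (isCompact_closedBall τ₀ 1)).image (by fun_prop)
  have hzero : ∀ p ∉ K, ∀ τ ∈ Metric.ball τ₀ 1, fderiv ℝ φ (p + τ • e) e = 0 := by
    intro p hp τ hτ
    have : p + τ • e ∉ tsupport φ := fun h =>
      hp ⟨(p + τ • e, τ), ⟨h, Metric.ball_subset_closedBall hτ⟩, by simp⟩
    rw [fderiv_of_notMem_tsupport ℝ this]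
    rfl
  have hmeas : AEStronglyMeasurable f μ := hf.aestronglyMeasurable
  refine (hasDerivAt_integral_of_dominated_loc_of_deriv_le
    (F' := fun τ p => f p * fderiv ℝ φ (p + τ • e) e)
    (bound := K.indicator fun p => ‖f p‖ * C)
    (Metric.ball_mem_nhds τ₀ one_pos) (Filter.Eventually.of_forall fun τ => ?_) ?_ ?_ ?_ ?_ ?_).2
  · exact hmeas.mul (hφ.continuous.comp (by fun_prop)).aestronglyMeasurable
  · exact hf.integrable_smul_right_of_hasCompactSupport (g := fun p => φ (p + τ₀ • e))
      (hφ.continuous.comp (by fun_prop))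
      (hφc.comp_homeomorph (Homeomorph.addRight (τ₀ • e)))
  · exact hmeas.mul (hcd.comp (by fun_prop)).aestronglyMeasurable
  · refine Filter.Eventually.of_forall fun p τ hτ => ?_
    by_cases hp : p ∈ K
    · rw [Set.indicator_of_mem hp, norm_mul]
      exact mul_le_mul_of_nonneg_left (hC _) (norm_nonneg _)
    · rw [Set.indicator_of_notMem hp, hzero p hp τ hτ, mul_zero, norm_zero]
  · exact (integrable_indicator_iff hK.measurableSet).2
      ((hf.integrableOn_isCompact hK).norm.mul_const C)
  · refine Filter.Eventually.of_forall fun p τ _ => ?_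
    have h1 : HasDerivAt (fun τ : ℝ => p + τ • e) e τ := by
      simpa using ((hasDerivAt_id τ).smul_const e).const_add p
    exact (((hφ.differentiable one_ne_zero _).hasFDerivAt).comp_hasDerivAt τ h1).const_mul (f p)

theorem ae_sub_smul_eq_of_integral_mul_fderiv_eq_zero [μ.IsAddHaarMeasure] {f : E → ℝ}
    (hf : LocallyIntegrable f μ) (e : E)
    (h : ∀ φ : E → ℝ, ContDiff ℝ (⊤ : ℕ∞) φ → HasCompactSupport φ →
      ∫ p, f p * fderiv ℝ φ p e ∂μ = 0) (τ : ℝ) :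
    ∀ᵐ p ∂μ, f (p - τ • e) = f p := by
  have hloc : LocallyIntegrable (fun p => f (p - τ • e)) μ := by
    refine (locallyIntegrable_map_homeomorph (Homeomorph.subRight (τ • e)) (f := f)).1 ?_
    have : Measure.map (Homeomorph.subRight (τ • e)) μ = μ :=
      (measurePreserving_sub_right μ (τ • e)).map_eq
    rwa [this]
  refine ae_eq_of_integral_contDiff_smul_eq hloc hf fun φ hφ hφc => ?_
  have hderiv : ∀ σ : ℝ, HasDerivAt (fun σ : ℝ => ∫ p, f p * φ (p + σ • e) ∂μ) 0 σ := by
    intro σ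
    have h1 := hasDerivAt_integral_mul_comp_add_smul hf (hφ.of_le (by simp)) hφc e σ
    have h2 := h (fun p => φ (p + σ • e)) (hφ.comp (contDiff_id.add contDiff_const))
      (hφc.comp_homeomorph (Homeomorph.addRight (σ • e)))
    simp only [fderiv_comp_add_right] at h2
    rwa [h2] at h1
  have hconst := is_const_of_deriv_eq_zero (fun σ => (hderiv σ).differentiableAt)
    (fun σ => (hderiv σ).deriv) τ 0
  calc ∫ p, φ p • f (p - τ • e) ∂μ
      = ∫ p, f p * φ (p + τ • e) ∂μ := by
        rw [← integral_add_right_eq_self _ (τ • e)]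
        simp [mul_comm]
    _ = ∫ p, φ p • f p ∂μ := by
        rw [hconst]
        simp [mul_comm]

end Translation

theorem ae_locallyIntegrable_prod_mk_right {f : ℝ × ℝ → ℝ} (hf : LocallyIntegrable f volume) :
    ∀ᵐ t : ℝ, LocallyIntegrable (fun s => f (s, t)) volume := by
  let B : ℕ → Set (ℝ × ℝ) := fun n => Metric.closedBall 0 n
  have hB : ∀ n : ℕ, ∀ᵐ t : ℝ, Integrable fun s => (B n).indicator f (s, t) := fun n =>
    ((integrable_indicator_iff Metric.isClosed_closedBall.measurableSet).2
      (hf.integrableOn_isCompact (isCompact_closedBall 0 (n : ℝ)))).prod_left_ae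
  filter_upwards [ae_all_iff.2 hB] with t ht
  refine locallyIntegrable_iff.2 fun K hK => ?_
  obtain ⟨R, hR⟩ := hK.isBounded.subset_closedBall 0
  obtain ⟨n, hn⟩ := exists_nat_ge (max R |t|)
  refine ((ht n).integrableOn (s := K)).congr_fun (fun s hs => ?_) hK.measurableSet
  refine Set.indicator_of_mem (mem_closedBall_zero_iff.2 ?_) f
  exact max_le ((mem_closedBall_zero_iff.1 (hR hs)).trans ((le_max_left _ _).trans hn))
    ((le_max_right _ _).trans hn)

theorem stmt9 (zt : ℝ × ℝ → ℝ) (c : ℝ) (hc : 0 < c)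
    (hloc : MeasureTheory.LocallyIntegrable zt MeasureTheory.volume)
    (hdist : ∀ φ : ℝ × ℝ → ℝ, ContDiff ℝ (⊤ : ℕ∞) φ → HasCompactSupport φ →
      ∫ p, zt p * (fderiv ℝ φ p (0, 1) - c * fderiv ℝ φ p (1, 0)) = 0) :
    ∃ zh : ℝ → ℝ, MeasureTheory.LocallyIntegrable zh MeasureTheory.volume ∧
      ∀ᵐ p : ℝ × ℝ, zt p = zh (p.1 / c + p.2) := by
  obtain ⟨g, hg, hzg⟩ := hloc.aestronglyMeasurable
  have hgm : Measurable g := hg.measurable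
  have hgloc : LocallyIntegrable g volume := hloc.congr hzg
  set e : ℝ × ℝ := (-c, 1) with he
  have htrans : ∀ τ : ℝ, ∀ᵐ p : ℝ × ℝ, g (p - τ • e) = g p := by
    refine ae_sub_smul_eq_of_integral_mul_fderiv_eq_zero hgloc e fun φ hφ hφc => ?_
    rw [← hdist φ hφ hφc]
    refine integral_congr_ae ?_
    filter_upwards [hzg] with p hp
    have : e = (0, 1) - c • ((1, 0) : ℝ × ℝ) := by simp [he]
    rw [hp, this, map_sub, map_smul, smul_eq_mul]
  have hpτ : ∀ᵐ p : ℝ × ℝ, ∀ᵐ τ : ℝ, g (p - τ • e) = g p :=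
    (Measure.ae_ae_comm (p := fun (τ : ℝ) (p : ℝ × ℝ) => g (p - τ • e) = g p)
      (measurableSet_eq_fun (by fun_prop) (by fun_prop))).1 (Filter.Eventually.of_forall htrans)
  have hpt : ∀ᵐ p : ℝ × ℝ, ∀ᵐ t : ℝ, g (c * (p.1 / c + p.2 - t), t) = g p := by
    filter_upwards [hpτ] with p hp
    have hq : Measure.QuasiMeasurePreserving (fun t : ℝ => p.2 - t) volume volume :=
      (Measure.measurePreserving_sub_left volume p.2).quasiMeasurePreserving
    filter_upwards [hq.ae hp] with t ht
    rw [← ht]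
    congr 1
    ext
    · simp [he]
      field_simp
      ring
    · simp [he]
  have htp : ∀ᵐ t : ℝ, ∀ᵐ p : ℝ × ℝ, g (c * (p.1 / c + p.2 - t), t) = g p :=
    (Measure.ae_ae_comm
      (p := fun (p : ℝ × ℝ) (t : ℝ) => g (c * (p.1 / c + p.2 - t), t) = g p)
      (measurableSet_eq_fun (by fun_prop) (by fun_prop))).1 hpt
  obtain ⟨t, ht, htloc⟩ := (htp.and (ae_locallyIntegrable_prod_mk_right hgloc)).exists
  refine ⟨fun u => g (c * (u - t), t), ?_, ?_⟩
  · have hmul : LocallyIntegrable (fun u => g (c * u, t)) volume := by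
      refine (locallyIntegrable_map_homeomorph (Homeomorph.mulLeft₀ c hc.ne')
        (f := fun s => g (s, t))).1 ?_
      have : Measure.map (Homeomorph.mulLeft₀ c hc.ne') volume
          = ENNReal.ofReal |c⁻¹| • (volume : Measure ℝ) := Real.map_volume_mul_left hc.ne'
      rw [this]
      intro x
      obtain ⟨U, hU, hUi⟩ := htloc x
      refine ⟨U, hU, ?_⟩
      rw [IntegrableOn, Measure.restrict_smul]
      exact Integrable.smul_measure hUi ENNReal.ofReal_ne_top
    refine (locallyIntegrable_map_homeomorph (Homeomorph.subRight t)
      (f := fun u => g (c * u, t))).1 ?_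
    have : Measure.map (Homeomorph.subRight t) volume = (volume : Measure ℝ) :=
      (measurePreserving_sub_right volume t).map_eq
    rwa [this]
  · filter_upwards [hzg, ht] with p hp htp
    rw [hp, htp]
end

section
/- Let V : ℝ^N → ℝ^N be smooth, ℤ^N-periodic, and divergence free, and fix P ∈ ℝ^N. Let z : ℝ^N → ℝ be continuous and bounded, and suppose div((z(·) + ⟨P,·⟩) V(·)) = 0 in the sense of distributions on ℝ^N. Then for every solution X of the ODE X'(s) = V(X(s)), the function s ↦ z(X(s)) + ⟨P, X(s)⟩ is constant. -/
open RealInnerProductSpace MeasureTheory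

section Mollification

open Metric Set ContinuousLinearMap
open scoped Convolution

variable {E : Type*} [NormedAddCommGroup E] [MeasurableSpace E] [BorelSpace E]

/-- Mollifiers at every scale `ε`, whose derivatives obey the scaling bound
`‖fderiv k‖ * ε * volume (ball of radius ε) ≤ M` with `M` independent of `ε`. -/
lemma exists_mollifier [InnerProductSpace ℝ E] [FiniteDimensional ℝ E]
    (μ : Measure E) [μ.IsAddHaarMeasure] :
    ∃ M : ℝ, 0 ≤ M ∧ ∀ ε : ℝ, 0 < ε → ∃ k : E → ℝ, ContDiff ℝ (⊤ : ℕ∞) k ∧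
      Function.support k ⊆ ball 0 ε ∧ (∀ x, 0 ≤ k x) ∧ ∫ x, k x ∂μ = 1 ∧
      ∃ B : ℝ, (∀ x, ‖fderiv ℝ k x‖ ≤ B) ∧ B * ε * μ.real (closedBall 0 ε) ≤ M := by
  let φ : ContDiffBump (0 : E) := ⟨1 / 2, 1, by norm_num, by norm_num⟩
  let ρ : E → ℝ := φ.normed μ
  have hρ : ContDiff ℝ (⊤ : ℕ∞) ρ := φ.contDiff_normed
  obtain ⟨C, hC⟩ := (φ.hasCompactSupport_normed (μ := μ)).fderiv (𝕜 := ℝ)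
    |>.exists_bound_of_continuous (hρ.continuous_fderiv (by simp))
  have hC0 : 0 ≤ C := (norm_nonneg _).trans (hC 0)
  refine ⟨C * μ.real (closedBall 0 1), by positivity, fun ε hε ↦ ?_⟩
  refine ⟨fun x ↦ (ε ^ Module.finrank ℝ E)⁻¹ * ρ (ε⁻¹ • x), ?_, ?_, ?_, ?_,
    (ε ^ Module.finrank ℝ E)⁻¹ * (ε⁻¹ * C), ?_, ?_⟩
  · exact contDiff_const.mul (hρ.comp (contDiff_const_smul _))
  · intro x hx
    have h1 : ε⁻¹ • x ∈ Function.support ρ := right_ne_zero_of_mul hx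
    rw [φ.support_normed_eq] at h1
    have h2 : ‖ε⁻¹ • x‖ < 1 := by simpa using h1
    rw [norm_smul, norm_inv, Real.norm_of_nonneg hε.le, inv_mul_lt_iff₀ hε] at h2
    simpa using h2
  · intro x
    have := φ.nonneg_normed (μ := μ) (ε⁻¹ • x)
    positivity
  · rw [integral_const_mul, Measure.integral_comp_inv_smul_of_nonneg μ ρ hε.le,
      φ.integral_normed, smul_eq_mul, mul_one, inv_mul_cancel₀ (by positivity)]
  · intro x
    have hd : DifferentiableAt ℝ (fun x ↦ ρ (ε⁻¹ • x)) x :=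
      ((hρ.comp (contDiff_const_smul _)).differentiable (by simp)) x
    rw [fderiv_const_mul hd, fderiv_comp_smul, norm_smul, norm_smul,
      Real.norm_of_nonneg (by positivity), Real.norm_of_nonneg (by positivity)]
    gcongr
    exact hC _
  · rw [Measure.addHaar_real_closedBall' μ _ hε.le]
    apply le_of_eq
    field_simp

/-- Commutator estimate: if `u V` and `V` are divergence free in the sense of distributions, then
the derivative along `V` of a mollification of `u` is controlled by the oscillation of `u`. -/
lemma abs_fderiv_convolution_le [NormedSpace ℝ E] [FiniteDimensional ℝ E]
    {μ : Measure E} [μ.IsAddHaarMeasure] {u : E → ℝ}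
    (hu : Continuous u) {V : E → E} (hV : Continuous V)
    (huV : ∀ ψ : E → ℝ, ContDiff ℝ (⊤ : ℕ∞) ψ → HasCompactSupport ψ →
      ∫ y, fderiv ℝ ψ y (u y • V y) ∂μ = 0)
    (hV0 : ∀ ψ : E → ℝ, ContDiff ℝ (⊤ : ℕ∞) ψ → HasCompactSupport ψ →
      ∀ v, ∫ y, fderiv ℝ ψ y (v - V y) ∂μ = 0)
    {k : E → ℝ} (hk : ContDiff ℝ (⊤ : ℕ∞) k) {ε B L δ : ℝ}
    (hks : Function.support k ⊆ ball 0 ε)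
    (hB : ∀ x, ‖fderiv ℝ k x‖ ≤ B) {x : E}
    (hL : ∀ y ∈ closedBall x ε, ‖V x - V y‖ ≤ L * ε)
    (hδ : ∀ y ∈ closedBall x ε, |u y - u x| ≤ δ) :
    ∃ D : E →L[ℝ] ℝ, HasFDerivAt (k ⋆[lsmul ℝ ℝ, μ] u) D x ∧
      |D (V x)| ≤ δ * (B * (L * ε)) * μ.real (closedBall 0 ε) := by
  have hkts : tsupport k ⊆ closedBall 0 ε :=
    closure_minimal (hks.trans ball_subset_closedBall) isClosed_closedBall
  have hkc : HasCompactSupport k :=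
    (isCompact_closedBall (0 : E) ε).of_isClosed_subset (isClosed_tsupport k) hkts
  have hdk : Continuous (fderiv ℝ k) := hk.continuous_fderiv (by simp)
  have hfar : ∀ y ∉ closedBall x ε, fderiv ℝ k (x - y) = 0 := by
    intro y hy
    by_contra hne
    have h1 : x - y ∈ tsupport (fderiv ℝ k) := subset_tsupport _ hne
    have h2 := hkts (tsupport_fderiv_subset ℝ h1)
    rw [mem_closedBall_zero_iff] at h2
    rw [mem_closedBall, dist_comm, dist_eq_norm] at hy
    exact hy h2
  let h : E → ℝ := fun y ↦ k (x - y)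
  have hhs : ContDiff ℝ (⊤ : ℕ∞) h := hk.comp (contDiff_const.sub contDiff_id)
  have hhc : HasCompactSupport h := by
    refine HasCompactSupport.intro (isCompact_closedBall x ε) fun y hy ↦ ?_
    by_contra hne
    have h2 := hkts (subset_tsupport k hne)
    rw [mem_closedBall_zero_iff] at h2
    rw [mem_closedBall, dist_comm, dist_eq_norm] at hy
    exact hy h2
  have hdh : ∀ y, fderiv ℝ h y = -fderiv ℝ k (x - y) := by
    intro y
    have hd := ((hk.differentiable (by simp)) (x - y)).hasFDerivAt.comp y
      ((hasFDerivAt_id y).const_sub x)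
    refine (HasFDerivAt.fderiv hd).trans ?_
    ext
    simp
  have hint : ∀ W : E → E, Continuous W → Integrable (fun y ↦ fderiv ℝ k (x - y) (W y)) μ := by
    intro W hW
    refine Continuous.integrable_of_hasCompactSupport
      ((hdk.comp (continuous_const.sub continuous_id)).clm_apply hW) ?_
    exact HasCompactSupport.intro (isCompact_closedBall x ε) fun y hy ↦ by simp [hfar y hy]
  have hD := hkc.hasFDerivAt_convolution_right (lsmul ℝ ℝ).flip
    (hu.locallyIntegrable (μ := μ)) (hk.of_le (by simp)) x
  rw [convolution_flip] at hD
  refine ⟨_, hD, ?_⟩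
  rw [convolution_precompR_apply _ hu.locallyIntegrable (hkc.fderiv ℝ) hdk, convolution_def]
  have e1 := huV h hhs hhc
  have e2 := hV0 h hhs hhc (V x)
  simp only [hdh, neg_apply, integral_neg, neg_eq_zero] at e1 e2
  have key : ∫ y, ((lsmul ℝ ℝ).flip (u y)) (fderiv ℝ k (x - y) (V x)) ∂μ
      = ∫ y, (u y - u x) * fderiv ℝ k (x - y) (V x - V y) ∂μ := by
    have i1 := hint (fun y ↦ u y • V x) (by fun_prop)
    have i2 := hint (fun y ↦ u y • V y) (by fun_prop)
    have i3 := (hint (fun y ↦ V x - V y) (by fun_prop)).const_mul (u x)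
    calc _ = ∫ y, fderiv ℝ k (x - y) (u y • V x) ∂μ := by
          congr with y; simp [mul_comm]
      _ = ∫ y, (fderiv ℝ k (x - y) (u y • V x) - fderiv ℝ k (x - y) (u y • V y))
            - u x * fderiv ℝ k (x - y) (V x - V y) ∂μ := by
          rw [integral_sub (by exact i1.sub i2) i3, integral_sub i1 i2, integral_const_mul, e1, e2]
          simp
      _ = _ := by
          congr with y
          simp only [map_smul, map_sub, smul_eq_mul]
          ring
  rw [← Real.norm_eq_abs, key,
    ← setIntegral_eq_integral_of_forall_compl_eq_zero (s := closedBall x ε)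
      fun y hy ↦ by simp [hfar y hy], ← Measure.addHaar_real_closedBall_center μ x]
  refine norm_setIntegral_le_of_norm_le_const measure_closedBall_lt_top fun y hy ↦ ?_
  rw [norm_mul]
  have h1 : ‖fderiv ℝ k (x - y) (V x - V y)‖ ≤ B * (L * ε) :=
    (le_opNorm _ _).trans (mul_le_mul (hB _) (hL y hy) (norm_nonneg _)
      ((norm_nonneg _).trans (hB 0)))
  exact mul_le_mul (hδ y hy) h1 (norm_nonneg _) ((abs_nonneg _).trans (hδ y hy))

/-- A continuous distributional first integral of a divergence free `C¹` vector field is constant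
along its integral curves. -/
theorem eq_of_integralCurve_of_distributional [InnerProductSpace ℝ E] [FiniteDimensional ℝ E]
    {μ : Measure E} [μ.IsAddHaarMeasure] {u : E → ℝ}
    (hu : Continuous u) {V : E → E} (hV : ContDiff ℝ 1 V)
    (huV : ∀ ψ : E → ℝ, ContDiff ℝ (⊤ : ℕ∞) ψ → HasCompactSupport ψ →
      ∫ y, fderiv ℝ ψ y (u y • V y) ∂μ = 0)
    (hV0 : ∀ ψ : E → ℝ, ContDiff ℝ (⊤ : ℕ∞) ψ → HasCompactSupport ψ →
      ∀ v, ∫ y, fderiv ℝ ψ y (v - V y) ∂μ = 0)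
    {X : ℝ → E} (hX : ∀ s, HasDerivAt X (V (X s)) s) (s₁ s₂ : ℝ) :
    u (X s₁) = u (X s₂) := by
  obtain ⟨M, hM, hmol⟩ := exists_mollifier μ
  have hXc : Continuous X := continuous_iff_continuousAt.2 fun s ↦ (hX s).continuousAt
  obtain ⟨R, hR⟩ := ((isCompact_uIcc (a := s₁) (b := s₂)).image hXc).isBounded.subset_closedBall 0
  have hXR : ∀ s ∈ uIcc s₁ s₂, ‖X s‖ ≤ R := fun s hs ↦ by simpa using hR (mem_image_of_mem X hs)
  have hK : IsCompact (closedBall (0 : E) (R + 1)) := isCompact_closedBall _ _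
  obtain ⟨L, hL⟩ := hK.exists_bound_of_continuousOn
    (hV.continuous_fderiv (by simp)).continuousOn
  have hL0 : 0 ≤ L := by
    refine (norm_nonneg _).trans (hL (X s₁) ?_)
    have := hXR s₁ left_mem_uIcc
    rw [mem_closedBall_zero_iff]
    linarith
  have huc := hK.uniformContinuousOn_of_continuous hu.continuousOn
  rw [Metric.uniformContinuousOn_iff_le] at huc
  have main : ∀ δ > 0, |u (X s₁) - u (X s₂)| ≤ δ * (2 + M * L * |s₂ - s₁|) := by
    intro δ hδ
    obtain ⟨ε₀, hε₀, hosc⟩ := huc δ hδ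
    set ε := min ε₀ 1
    have hε : 0 < ε := lt_min hε₀ one_pos
    obtain ⟨k, hk, hks, hk0, hk1, B, hB, hBM⟩ := hmol ε hε
    have hmem : ∀ s ∈ uIcc s₁ s₂, ∀ y ∈ closedBall (X s) ε, y ∈ closedBall (0 : E) (R + 1) := by
      intro s hs y hy
      refine closedBall_subset_closedBall' ?_ hy
      rw [dist_zero_right]
      linarith [hXR s hs, min_le_right ε₀ 1]
    have hself : ∀ s, X s ∈ closedBall (X s) ε := fun s ↦ mem_closedBall_self hε.le
    have hosc' : ∀ s ∈ uIcc s₁ s₂, ∀ y ∈ closedBall (X s) ε, |u y - u (X s)| ≤ δ :=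
      fun s hs y hy ↦ hosc y (hmem s hs y hy) (X s) (hmem s hs _ (hself s))
        ((mem_closedBall.1 hy).trans (min_le_left _ _))
    have hlip : ∀ s ∈ uIcc s₁ s₂, ∀ y ∈ closedBall (X s) ε, ‖V (X s) - V y‖ ≤ L * ε := by
      intro s hs y hy
      refine ((convex_closedBall (0 : E) (R + 1)).norm_image_sub_le_of_norm_fderiv_le (𝕜 := ℝ)
        (fun x _ ↦ (hV.differentiable (by simp)) x) hL (hmem s hs y hy)
        (hmem s hs _ (hself s))).trans ?_
      gcongr
      rw [← dist_eq_norm, dist_comm]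
      exact hy
    have hclose : ∀ s ∈ uIcc s₁ s₂, |(k ⋆[lsmul ℝ ℝ, μ] u) (X s) - u (X s)| ≤ δ :=
      fun s hs ↦ dist_convolution_le hδ.le hks hk0 hk1 hu.aestronglyMeasurable
        fun y hy ↦ hosc' s hs y (ball_subset_closedBall hy)
    have hder : ∀ s ∈ uIcc s₁ s₂, ∃ f' : ℝ,
        HasDerivAt (fun s ↦ (k ⋆[lsmul ℝ ℝ, μ] u) (X s)) f' s ∧ ‖f'‖ ≤ δ * (M * L) := by
      intro s hs
      obtain ⟨D, hD, hDV⟩ := abs_fderiv_convolution_le hu hV.continuous huV hV0 hk hks hB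
        (hlip s hs) (hosc' s hs)
      refine ⟨_, hD.comp_hasDerivAt s (hX s), hDV.trans ?_⟩
      calc _ = δ * (B * ε * μ.real (closedBall 0 ε) * L) := by ring
        _ ≤ _ := by gcongr
    choose! f' hf' hf'b using hder
    have hmv := (convex_uIcc s₁ s₂).norm_image_sub_le_of_norm_hasDerivWithin_le
      (fun s hs ↦ (hf' s hs).hasDerivWithinAt) hf'b left_mem_uIcc right_mem_uIcc
    simp only [Real.norm_eq_abs] at hmv
    have h1 := hclose s₁ left_mem_uIcc
    have h2 := hclose s₂ right_mem_uIcc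
    rw [abs_le] at h1 h2 hmv ⊢
    constructor <;> linarith
  have hlim : Filter.Tendsto (fun δ : ℝ ↦ δ * (2 + M * L * |s₂ - s₁|))
      (nhdsWithin 0 (Ioi 0)) (nhds 0) := by
    have : Continuous fun δ : ℝ ↦ δ * (2 + M * L * |s₂ - s₁|) := by fun_prop
    simpa using (this.tendsto 0).mono_left nhdsWithin_le_nhds
  have h0 : |u (X s₁) - u (X s₂)| ≤ 0 :=
    ge_of_tendsto hlim (Filter.eventually_of_mem self_mem_nhdsWithin main)
  exact sub_eq_zero.1 (abs_nonpos_iff.1 h0)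

end Mollification

/-- A `C¹` vector field with vanishing divergence is divergence free in the sense of
distributions. -/
lemma integral_fderiv_apply_eq_zero_of_divergence_eq_zero {ι : Type*} [Fintype ι] [DecidableEq ι]
    {W : EuclideanSpace ℝ ι → EuclideanSpace ℝ ι} (hW : ContDiff ℝ 1 W)
    (hdiv : ∀ x, ∑ i, fderiv ℝ (fun y ↦ W y i) x (EuclideanSpace.single i 1) = 0)
    {ψ : EuclideanSpace ℝ ι → ℝ} (hψ : ContDiff ℝ 1 ψ) (hψc : HasCompactSupport ψ) :
    ∫ y, fderiv ℝ ψ y (W y) = 0 := by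
  have hWi : ∀ i, ContDiff ℝ 1 fun y ↦ W y i := fun i ↦ contDiff_euclidean.1 hW i
  have hdψ : Continuous (fderiv ℝ ψ) := hψ.continuous_fderiv (by simp)
  have i1 : ∀ i, Integrable fun y ↦ fderiv ℝ ψ y (EuclideanSpace.single i 1) * W y i := fun i ↦
    Continuous.integrable_of_hasCompactSupport
      ((hdψ.clm_apply continuous_const).mul (hWi i).continuous)
      ((hψc.fderiv_apply ℝ _).mul_right)
  have i2 : ∀ i, Integrable fun y ↦
      ψ y * fderiv ℝ (fun y ↦ W y i) y (EuclideanSpace.single i 1) := fun i ↦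
    Continuous.integrable_of_hasCompactSupport
      (hψ.continuous.mul (((hWi i).continuous_fderiv (by simp)).clm_apply continuous_const))
      hψc.mul_right
  have i3 : ∀ i, Integrable fun y ↦ ψ y * W y i := fun i ↦
    Continuous.integrable_of_hasCompactSupport (hψ.continuous.mul (hWi i).continuous)
      hψc.mul_right
  have hexp : ∀ y, fderiv ℝ ψ y (W y)
      = ∑ i, fderiv ℝ ψ y (EuclideanSpace.single i 1) * W y i := by
    intro y
    conv_lhs => rw [← (EuclideanSpace.basisFun ι ℝ).sum_repr (W y)]
    simp [mul_comm]
  have hparts : ∀ i, ∫ y, fderiv ℝ ψ y (EuclideanSpace.single i 1) * W y i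
      = -∫ y, ψ y * fderiv ℝ (fun y ↦ W y i) y (EuclideanSpace.single i 1) := fun i ↦ by
    rw [integral_mul_fderiv_eq_neg_fderiv_mul_of_integrable (i1 i) (i2 i) (i3 i)
      (fun x _ ↦ hψ.differentiable (by simp) x) (fun x _ ↦ (hWi i).differentiable (by simp) x),
      neg_neg]
  simp_rw [hexp]
  rw [integral_finsetSum _ fun i _ ↦ i1 i]
  simp_rw [hparts]
  rw [Finset.sum_neg_distrib, ← integral_finsetSum _ fun i _ ↦ i2 i]
  simp [← Finset.mul_sum, hdiv]

theorem stmt13 (N : ℕ) (V : EuclideanSpace ℝ (Fin N) → EuclideanSpace ℝ (Fin N))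
    (hV : ContDiff ℝ (⊤ : ℕ∞) V)
    (hper : ∀ (x : EuclideanSpace ℝ (Fin N)) (k : Fin N → ℤ),
      V (x + (WithLp.equiv 2 (Fin N → ℝ)).symm (fun i => (k i : ℝ))) = V x)
    (hdiv : ∀ x : EuclideanSpace ℝ (Fin N),
      ∑ i, fderiv ℝ (fun y => V y i) x (EuclideanSpace.single i 1) = 0)
    (P : EuclideanSpace ℝ (Fin N))
    (z : EuclideanSpace ℝ (Fin N) → ℝ) (hz : Continuous z) (hzb : ∃ C, ∀ x, |z x| ≤ C)
    (hdist : ∀ ψ : EuclideanSpace ℝ (Fin N) → ℝ, ContDiff ℝ (⊤ : ℕ∞) ψ → HasCompactSupport ψ →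
      ∫ x, ⟪gradient ψ x, (z x + ⟪P, x⟫) • V x⟫ = 0) :
    ∀ X : ℝ → EuclideanSpace ℝ (Fin N), (∀ s, HasDerivAt X (V (X s)) s) →
      ∀ s₁ s₂, z (X s₁) + ⟪P, X s₁⟫ = z (X s₂) + ⟪P, X s₂⟫ := by
  intro X hX s₁ s₂
  have hV1 : ContDiff ℝ 1 V := hV.of_le (by simp)
  refine eq_of_integralCurve_of_distributional (μ := volume) (u := fun x ↦ z x + ⟪P, x⟫)
    (by fun_prop) hV1 (fun ψ hψ hψc ↦ ?_) (fun ψ hψ hψc v ↦ ?_) hX s₁ s₂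
  · simpa only [inner_gradient_left] using hdist ψ hψ hψc
  · refine integral_fderiv_apply_eq_zero_of_divergence_eq_zero (W := fun y ↦ v - V y)
      (contDiff_const.sub hV1) (fun x ↦ ?_) (hψ.of_le (by simp)) hψc
    simp only [PiLp.sub_apply, fderiv_const_sub, neg_apply, Finset.sum_neg_distrib, hdiv, neg_zero]
end
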